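/- Fix ϱ > 0 and assume |θ| > ϱ and d·θ² ≤ 1. For any 0 < ε < 1 there exist N2 = N2(π, ε) and δ = δ(π, ε, ϱ) > 0 such that if n ≥ N2 and x_n ≤ δ then |z_n − π1·x_n| ≤ ε·x_n. -/

import Mathlib

open Finset Filter

namespace AsymIsing

/-- Level-`k` vertices of the rooted `d`-ary tree: paths of length `k` from the root. -/
abbrev Vert (d k : ℕ) : Type := Fin k → Fin d

/-- A spin configuration on levels `0, …, n` of the `d`-ary tree. -/
abbrev Conf (d n : ℕ) : Type := ∀ k : Fin (n + 1), Vert d k → Fin 2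

/-- A spin configuration on level `n` only. -/
abbrev LConf (d n : ℕ) : Type := Vert d n → Fin 2

/-- The transition matrix of the asymmetric binary channel; the paper's state `1`
corresponds to the index `0` and the state `2` to the index `1`. -/
noncomputable def Mmat (θ Δ : ℝ) : Fin 2 → Fin 2 → ℝ := fun i j =>
  if i = 0 then (if j = 0 then (1 + θ - Δ) / 2 else (1 - θ + Δ) / 2)
  else (if j = 0 then (1 - θ - Δ) / 2 else (1 + θ + Δ) / 2)

/-- The stationary distribution `π = (π₁, π₂)` of the channel. -/
noncomputable def pst (θ Δ : ℝ) : Fin 2 → ℝ := fun i =>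
  if i = 0 then 1 / 2 - Δ / (2 * (1 - θ)) else 1 / 2 + Δ / (2 * (1 - θ))

/-- The root spin of a configuration. -/
def root {d n : ℕ} (σ : Conf d n) : Fin 2 := σ ⟨0, n.succ_pos⟩ (fun i => i.elim0)

/-- The restriction of a configuration to the last (`n`-th) level. -/
def top {d n : ℕ} (σ : Conf d n) : LConf d n := σ (Fin.last n)

/-- The probability of a full configuration on levels `0, …, n` under the broadcast
process: the root is drawn from `π` and spins propagate along edges via `M`. -/
noncomputable def confProb (d : ℕ) (θ Δ : ℝ) (n : ℕ) (σ : Conf d n) : ℝ :=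
  pst θ Δ (root σ) *
    ∏ k : Fin n, ∏ v : Vert d (k + 1),
      Mmat θ Δ (σ k.castSucc (v ∘ Fin.castSucc)) (σ k.succ v)

/-- `P(σ(n) = A)`: the marginal law of the level-`n` spins. -/
noncomputable def levelProb (d : ℕ) (θ Δ : ℝ) (n : ℕ) (A : LConf d n) : ℝ :=
  ∑ σ : Conf d n, if top σ = A then confProb d θ Δ n σ else 0

/-- `P(σ_ρ = i, σ(n) = A)`. -/
noncomputable def jointProb (d : ℕ) (θ Δ : ℝ) (n : ℕ) (i : Fin 2) (A : LConf d n) : ℝ :=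
  ∑ σ : Conf d n, if root σ = i ∧ top σ = A then confProb d θ Δ n σ else 0

/-- The posterior `f_n(i, A) = P(σ_ρ = i ∣ σ(n) = A)`. -/
noncomputable def post (d : ℕ) (θ Δ : ℝ) (n : ℕ) (i : Fin 2) (A : LConf d n) : ℝ :=
  jointProb d θ Δ n i A / levelProb d θ Δ n A

/-- The law of `σ^i(n)`, i.e. `P(σ(n) = A ∣ σ_ρ = i)`. -/
noncomputable def condLevel (d : ℕ) (θ Δ : ℝ) (n : ℕ) (i : Fin 2) (A : LConf d n) : ℝ :=
  jointProb d θ Δ n i A / pst θ Δ i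

/-- The total variation distance between `σ^1(n)` and `σ^2(n)`. -/
noncomputable def tvDist (d : ℕ) (θ Δ : ℝ) (n : ℕ) : ℝ :=
  (1 / 2) * ∑ A : LConf d n, |condLevel d θ Δ n 0 A - condLevel d θ Δ n 1 A|

/-- The reconstruction problem is solvable if `limsup_n d_TV(σ^1(n), σ^2(n)) > 0`. -/
def solvable (d : ℕ) (θ Δ : ℝ) : Prop :=
  0 < Filter.limsup (fun n => tvDist d θ Δ n) Filter.atTop

/-- Non-reconstruction: `limsup_n d_TV(σ^1(n), σ^2(n)) = 0`. -/
def nonReconstruction (d : ℕ) (θ Δ : ℝ) : Prop :=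
  Filter.limsup (fun n => tvDist d θ Δ n) Filter.atTop = 0

/-- Expectation of a function of the level-`n` configuration, conditioned on `σ_ρ = 1`. -/
noncomputable def expect1 (d : ℕ) (θ Δ : ℝ) (n : ℕ) (g : LConf d n → ℝ) : ℝ :=
  ∑ A : LConf d n, condLevel d θ Δ n 0 A * g A

/-- `x_n = E f_n(1, σ^1(n)) − π₁`. -/
noncomputable def xseq (d : ℕ) (θ Δ : ℝ) (n : ℕ) : ℝ :=
  expect1 d θ Δ n (fun A => post d θ Δ n 0 A) - pst θ Δ 0

/-- `z_n = E (f_n(1, σ^1(n)) − π₁)²`. -/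
noncomputable def zseq (d : ℕ) (θ Δ : ℝ) (n : ℕ) : ℝ :=
  expect1 d θ Δ n (fun A => (post d θ Δ n 0 A - pst θ Δ 0) ^ 2)

/-- The restriction of a level-`(n+1)` configuration to the subtree of the `j`-th
child of the root (paths starting with `j`). -/
def restrictChild {d n : ℕ} (j : Fin d) (A : LConf d (n + 1)) : LConf d n :=
  fun w => A (Fin.cons j w)

/-- `Y_j = f_n(1, σ_j(n+1))`, as a function of the level-`(n+1)` configuration. -/
noncomputable def Yfun (d : ℕ) (θ Δ : ℝ) (n : ℕ) (j : Fin d) (A : LConf d (n + 1)) : ℝ :=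
  post d θ Δ n 0 (restrictChild j A)

/-- `Z₁ = ∏_j (1 + (θ/π₁)(Y_j − π₁))`, as a function of the level-`(n+1)` configuration. -/
noncomputable def Z1fun (d : ℕ) (θ Δ : ℝ) (n : ℕ) (A : LConf d (n + 1)) : ℝ :=
  ∏ j : Fin d, (1 + (θ / pst θ Δ 0) * (Yfun d θ Δ n j A - pst θ Δ 0))

/-- `Z₂ = ∏_j (1 − (θ/π₂)(Y_j − π₁))`, as a function of the level-`(n+1)` configuration. -/
noncomputable def Z2fun (d : ℕ) (θ Δ : ℝ) (n : ℕ) (A : LConf d (n + 1)) : ℝ :=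
  ∏ j : Fin d, (1 - (θ / pst θ Δ 1) * (Yfun d θ Δ n j A - pst θ Δ 0))

/-- The value of `Δ` making `π = (π₁, π₂)` the stationary distribution of the channel
with second eigenvalue `θ`, namely `Δ = (1 − θ)(π₂ − π₁)`. -/
noncomputable def Dlt (θ π1 π2 : ℝ) : ℝ := (1 - θ) * (π2 - π1)

/-- The Gaussian-approximation function
`f(s) = E[π₁ e^{sμ₁+√s W₁} / (π₁ e^{sμ₁+√s W₁} + π₂ e^{sμ₂+√s W₂})] − π₁`,
where `μ₁ = 1/(2π₁)`, `μ₂ = −(1+π₂)/(2π₂²)`, `W₁ ∼ N(0, 1/π₁)` (realized as `w/√π₁`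
for `w` standard Gaussian) and `W₂ = −(π₁/π₂)·W₁`. -/
noncomputable def gfun (π1 π2 : ℝ) (s : ℝ) : ℝ :=
  (∫ w : ℝ,
      (π1 * Real.exp (s * (1 / (2 * π1)) + Real.sqrt s * (w / Real.sqrt π1))) /
        (π1 * Real.exp (s * (1 / (2 * π1)) + Real.sqrt s * (w / Real.sqrt π1)) +
          π2 * Real.exp (s * (-(1 + π2) / (2 * π2 ^ 2)) +
            Real.sqrt s * (-(π1 / π2) * (w / Real.sqrt π1))))
    ∂(ProbabilityTheory.gaussianReal 0 1)) - π1

/-- The total mass at an outcome with likelihoods `p`, `q` under the prior `(π1, π2)`. -/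
noncomputable def mix (π1 π2 p q : ℝ) : ℝ := π1 * p + π2 * q

/-- The deviation of the posterior probability of the first state from its prior `π1`, at an
outcome with likelihoods `p`, `q`. -/
noncomputable def dev (π1 π2 p q : ℝ) : ℝ := π1 * π2 * (p - q) / mix π1 π2 p q

section Pointwise

variable {π1 π2 : ℝ}

lemma mix_nonneg (h1 : 0 < π1) (h2 : 0 < π2) {p q : ℝ} (hp : 0 ≤ p) (hq : 0 ≤ q) :
    0 ≤ mix π1 π2 p q := by
  unfold mix; positivity

lemma mix_mul_dev (h1 : 0 < π1) (h2 : 0 < π2) {p q : ℝ} (hp : 0 ≤ p) (hq : 0 ≤ q) :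
    mix π1 π2 p q * dev π1 π2 p q = π1 * π2 * (p - q) := by
  unfold dev
  rcases eq_or_ne (mix π1 π2 p q) 0 with h | h
  · unfold mix at h
    have hp' : π1 * p = 0 := by nlinarith [mul_nonneg h1.le hp, mul_nonneg h2.le hq]
    have hq' : π2 * q = 0 := by nlinarith [mul_nonneg h1.le hp, mul_nonneg h2.le hq]
    have hp0 : p = 0 := by simpa [h1.ne'] using hp'
    have hq0 : q = 0 := by simpa [h2.ne'] using hq'
    simp [hp0, hq0]
  · field_simp

lemma neg_le_dev (hsum : π1 + π2 = 1) (h1 : 0 < π1) (h2 : 0 < π2) {p q : ℝ} (hp : 0 ≤ p)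
    (hq : 0 ≤ q) : -π1 ≤ dev π1 π2 p q := by
  rcases (mix_nonneg h1 h2 hp hq).eq_or_lt with h | h
  · simp [dev, ← h, h1.le]
  · rw [dev, le_div_iff₀ h]
    obtain rfl : π2 = 1 - π1 := by linarith
    unfold mix
    nlinarith [mul_nonneg h1.le hp]

lemma dev_le (hsum : π1 + π2 = 1) (h1 : 0 < π1) (h2 : 0 < π2) {p q : ℝ} (hp : 0 ≤ p)
    (hq : 0 ≤ q) : dev π1 π2 p q ≤ π2 := by
  rcases (mix_nonneg h1 h2 hp hq).eq_or_lt with h | h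
  · simp [dev, ← h, h2.le]
  · rw [dev, div_le_iff₀ h]
    obtain rfl : π2 = 1 - π1 := by linarith
    unfold mix
    nlinarith [mul_nonneg h2.le hq]

lemma abs_dev_le_one (hsum : π1 + π2 = 1) (h1 : 0 < π1) (h2 : 0 < π2) {p q : ℝ} (hp : 0 ≤ p)
    (hq : 0 ≤ q) : |dev π1 π2 p q| ≤ 1 :=
  abs_le.2 ⟨by linarith [neg_le_dev hsum h1 h2 hp hq], by linarith [dev_le hsum h1 h2 hp hq]⟩

lemma prior_mul_likelihood (hsum : π1 + π2 = 1) (h1 : 0 < π1) (h2 : 0 < π2) {p q : ℝ}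
    (hp : 0 ≤ p) (hq : 0 ≤ q) :
    π1 * p = mix π1 π2 p q * (π1 + dev π1 π2 p q) := by
  rw [mul_add, mix_mul_dev h1 h2 hp hq]
  obtain rfl : π2 = 1 - π1 := by linarith
  unfold mix; ring

/-- The joint density of two independent observations relative to the product of the marginals. -/
noncomputable def pairDensity (π1 π2 a b : ℝ) : ℝ := 1 + a * b / (π1 * π2)

/-- The numerator of the deviation of the posterior after two independent observations. -/
noncomputable def pairNum (π1 π2 a b : ℝ) : ℝ :=
  a + b + (π2 - π1) / (π1 * π2) * (a * b)

lemma abs_pairNum_le (hsum : π1 + π2 = 1) (h1 : 0 < π1) (h2 : 0 < π2) {a b : ℝ}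
    (ha : -π1 ≤ a) (ha' : a ≤ π2) (hb : -π1 ≤ b) (hb' : b ≤ π2) :
    |pairNum π1 π2 a b| ≤ pairDensity π1 π2 a b := by
  have e1 : pairDensity π1 π2 a b =
      (π1 + a) * (π1 + b) / π1 + (π2 - a) * (π2 - b) / π2 := by
    unfold pairDensity
    obtain rfl : π2 = 1 - π1 := by linarith
    field_simp; ring
  have e2 : pairNum π1 π2 a b =
      π2 * ((π1 + a) * (π1 + b) / π1) - π1 * ((π2 - a) * (π2 - b) / π2) := by
    unfold pairNum
    obtain rfl : π2 = 1 - π1 := by linarith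
    field_simp; ring
  have n1 : 0 ≤ (π1 + a) * (π1 + b) / π1 :=
    div_nonneg (mul_nonneg (by linarith) (by linarith)) h1.le
  have n2 : 0 ≤ (π2 - a) * (π2 - b) / π2 :=
    div_nonneg (mul_nonneg (by linarith) (by linarith)) h2.le
  rw [e1, e2, abs_le]
  obtain rfl : π2 = 1 - π1 := by linarith
  constructor <;> nlinarith

lemma mix_mul (hsum : π1 + π2 = 1) (h1 : 0 < π1) (h2 : 0 < π2) {p q p' q' : ℝ}
    (hp : 0 ≤ p) (hq : 0 ≤ q) (hp' : 0 ≤ p') (hq' : 0 ≤ q') :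
    mix π1 π2 (p * p') (q * q') = mix π1 π2 p q * mix π1 π2 p' q' *
      pairDensity π1 π2 (dev π1 π2 p q) (dev π1 π2 p' q') := by
  have e := mix_mul_dev h1 h2 hp hq
  have e' := mix_mul_dev h1 h2 hp' hq'
  have : mix π1 π2 p q * mix π1 π2 p' q' *
      pairDensity π1 π2 (dev π1 π2 p q) (dev π1 π2 p' q') =
      mix π1 π2 p q * mix π1 π2 p' q' + (mix π1 π2 p q * dev π1 π2 p q) *
        (mix π1 π2 p' q' * dev π1 π2 p' q') / (π1 * π2) := by
    unfold pairDensity; ring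
  rw [this, e, e']
  unfold mix
  obtain rfl : π2 = 1 - π1 := by linarith
  field_simp; ring

lemma mix_mul_dev_mul (hsum : π1 + π2 = 1) (h1 : 0 < π1) (h2 : 0 < π2) {p q p' q' : ℝ}
    (hp : 0 ≤ p) (hq : 0 ≤ q) (hp' : 0 ≤ p') (hq' : 0 ≤ q') :
    π1 * π2 * (p * p' - q * q') = mix π1 π2 p q * mix π1 π2 p' q' *
      pairNum π1 π2 (dev π1 π2 p q) (dev π1 π2 p' q') := by
  have e := mix_mul_dev h1 h2 hp hq
  have e' := mix_mul_dev h1 h2 hp' hq'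
  have : mix π1 π2 p q * mix π1 π2 p' q' *
      pairNum π1 π2 (dev π1 π2 p q) (dev π1 π2 p' q') =
      (mix π1 π2 p q * dev π1 π2 p q) * mix π1 π2 p' q' +
      mix π1 π2 p q * (mix π1 π2 p' q' * dev π1 π2 p' q') +
      (π2 - π1) / (π1 * π2) * ((mix π1 π2 p q * dev π1 π2 p q) *
        (mix π1 π2 p' q' * dev π1 π2 p' q')) := by
    unfold pairNum; ring
  rw [this, e, e']
  unfold mix
  obtain rfl : π2 = 1 - π1 := by linarith
  field_simp; ring

lemma mix_mul_dev_pow_mul (hsum : π1 + π2 = 1) (h1 : 0 < π1) (h2 : 0 < π2) {p q p' q' : ℝ}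
    (hp : 0 ≤ p) (hq : 0 ≤ q) (hp' : 0 ≤ p') (hq' : 0 ≤ q') (k : ℕ) :
    mix π1 π2 (p * p') (q * q') * dev π1 π2 (p * p') (q * q') ^ k =
      mix π1 π2 p q * mix π1 π2 p' q' *
        (pairDensity π1 π2 (dev π1 π2 p q) (dev π1 π2 p' q') *
          (pairNum π1 π2 (dev π1 π2 p q) (dev π1 π2 p' q') /
            pairDensity π1 π2 (dev π1 π2 p q) (dev π1 π2 p' q')) ^ k) := by
  rcases eq_or_ne (mix π1 π2 p q * mix π1 π2 p' q') 0 with h | h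
  · rw [mix_mul hsum h1 h2 hp hq hp' hq', h]; simp
  · rw [dev, mix_mul_dev_mul hsum h1 h2 hp hq hp' hq', mix_mul hsum h1 h2 hp hq hp' hq',
      mul_div_mul_left _ _ h, mul_assoc]

/-- The second-order expansion of the second moment density of a pair of observations. -/
lemma exists_pair_sq_bound (hsum : π1 + π2 = 1) (h1 : 0 < π1) (h2 : 0 < π2) :
    ∃ C : ℝ, 0 ≤ C ∧ ∃ c₁ c₂ : ℝ, ∀ a b : ℝ, -π1 ≤ a → a ≤ π2 → -π1 ≤ b → b ≤ π2 →
      |pairDensity π1 π2 a b * (pairNum π1 π2 a b / pairDensity π1 π2 a b) ^ 2 -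
        (a ^ 2 + b ^ 2 + 2 * (a * b) + c₁ * (a ^ 2 * b + a * b ^ 2) +
          c₂ * (a ^ 3 * b + a * b ^ 3))| ≤ C * (a ^ 2 * b ^ 2) := by
  set l : ℝ := (π1 * π2)⁻¹ with hl
  set κ : ℝ := (π2 - π1) / (π1 * π2) with hκ
  obtain ⟨C, hC⟩ := (isCompact_Icc.prod isCompact_Icc :
    IsCompact (Set.Icc (-π1) π2 ×ˢ Set.Icc (-π1) π2)).exists_bound_of_continuousOn
    (f := fun x : ℝ × ℝ => κ ^ 2 - 2 * l - 2 * l * κ * (x.1 + x.2) - l * κ ^ 2 * (x.1 * x.2))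
    (by fun_prop)
  obtain ⟨C', hC'⟩ := (isCompact_Icc.prod isCompact_Icc :
    IsCompact (Set.Icc (-π1) π2 ×ˢ Set.Icc (-π1) π2)).exists_bound_of_continuousOn
    (f := fun x : ℝ × ℝ => l ^ 2 * (1 + l * (x.1 * x.2))) (by fun_prop)
  refine ⟨|C| + |C'|, by positivity, 2 * κ, -l, fun a b ha ha' hb hb' => ?_⟩
  have hx : ((a, b) : ℝ × ℝ) ∈ Set.Icc (-π1) π2 ×ˢ Set.Icc (-π1) π2 := ⟨⟨ha, ha'⟩, hb, hb'⟩
  have bC := hC _ hx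
  have bC' := hC' _ hx
  have hN := abs_pairNum_le hsum h1 h2 ha ha' hb hb'
  have eD : pairDensity π1 π2 a b = 1 + l * (a * b) := by
    rw [pairDensity, hl]; ring
  have eN : pairNum π1 π2 a b = a + b + κ * (a * b) := rfl
  set D := pairDensity π1 π2 a b
  set N := pairNum π1 π2 a b
  have hD : 0 ≤ D := (abs_nonneg _).trans hN
  set W := N / D with hW
  have hNW : N = W * D := by
    rcases hD.eq_or_lt with h | h
    · rw [← h] at hN ⊢
      simpa using hN
    · rw [hW]; field_simp
  have hW1 : |W| ≤ 1 := by
    rw [hW, abs_div, abs_of_nonneg hD]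
    exact div_le_one_of_le₀ hN hD
  have key : D * W ^ 2 - (a ^ 2 + b ^ 2 + 2 * (a * b) + 2 * κ * (a ^ 2 * b + a * b ^ 2) +
          -l * (a ^ 3 * b + a * b ^ 3)) = (a ^ 2 * b ^ 2) *
      ((κ ^ 2 - 2 * l - 2 * l * κ * (a + b) - l * κ ^ 2 * (a * b)) +
        l ^ 2 * (1 + l * (a * b)) * W ^ 2) := by
    have : D * W ^ 2 = N ^ 2 * (1 - l * (a * b)) + l ^ 2 * D * W ^ 2 * (a * b) ^ 2 := by
      have : l * (a * b) = D - 1 := by rw [eD]; ring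
      rw [hNW]
      linear_combination (- l * a * b * D * W ^ 2 - (D - 1) * D * W ^ 2 + W ^ 2 * D ^ 2) * this
    rw [this, ← eD, eN]
    ring
  rw [key, abs_mul, abs_of_nonneg (by positivity : 0 ≤ a ^ 2 * b ^ 2), mul_comm]
  gcongr
  refine (abs_add_le _ _).trans (add_le_add (bC.trans (le_abs_self _)) ?_)
  rw [abs_mul]
  have hW2 : |W ^ 2| ≤ 1 := by
    rw [abs_pow]; exact pow_le_one₀ (abs_nonneg _) hW1
  calc _ ≤ |l ^ 2 * (1 + l * (a * b))| * 1 := by gcongr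
    _ ≤ |C'| := by rw [mul_one]; exact bC'.trans (le_abs_self _)

/-- The second-order expansion of the third moment density of a pair of observations. -/
lemma exists_pair_cube_bound (hsum : π1 + π2 = 1) (h1 : 0 < π1) (h2 : 0 < π2) :
    ∃ C : ℝ, 0 ≤ C ∧ ∃ c₁ c₂ : ℝ, ∀ a b : ℝ, -π1 ≤ a → a ≤ π2 → -π1 ≤ b → b ≤ π2 →
      |pairDensity π1 π2 a b * (pairNum π1 π2 a b / pairDensity π1 π2 a b) ^ 3 -
        (a ^ 3 + b ^ 3 + 3 * (a ^ 2 * b + a * b ^ 2) + c₁ * (a ^ 3 * b + a * b ^ 3) +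
          c₂ * (a ^ 4 * b + a * b ^ 4))| ≤ C * (a ^ 2 * b ^ 2) := by
  set l : ℝ := (π1 * π2)⁻¹ with hl
  set κ : ℝ := (π2 - π1) / (π1 * π2) with hκ
  obtain ⟨C, hC⟩ := (isCompact_Icc.prod isCompact_Icc :
    IsCompact (Set.Icc (-π1) π2 ×ˢ Set.Icc (-π1) π2)).exists_bound_of_continuousOn
    (f := fun x : ℝ × ℝ => 6 * κ + 3 * (x.1 + x.2) * κ ^ 2 + κ ^ 3 * (x.1 * x.2) -
      6 * l * (x.1 + x.2) - 6 * l * κ * (x.1 + x.2) ^ 2 -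
      6 * l * (x.1 + x.2) * κ ^ 2 * (x.1 * x.2) - 2 * l * κ ^ 3 * (x.1 * x.2) ^ 2)
    (by fun_prop)
  obtain ⟨C', hC'⟩ := (isCompact_Icc.prod isCompact_Icc :
    IsCompact (Set.Icc (-π1) π2 ×ˢ Set.Icc (-π1) π2)).exists_bound_of_continuousOn
    (f := fun x : ℝ × ℝ => l ^ 2 * ((1 + l * (x.1 * x.2)) * (2 * (1 + l * (x.1 * x.2)) + 1)))
    (by fun_prop)
  refine ⟨|C| + |C'|, by positivity, 3 * κ, -2 * l, fun a b ha ha' hb hb' => ?_⟩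
  have hx : ((a, b) : ℝ × ℝ) ∈ Set.Icc (-π1) π2 ×ˢ Set.Icc (-π1) π2 := ⟨⟨ha, ha'⟩, hb, hb'⟩
  have bC := hC _ hx
  have bC' := hC' _ hx
  have hN := abs_pairNum_le hsum h1 h2 ha ha' hb hb'
  have eD : pairDensity π1 π2 a b = 1 + l * (a * b) := by
    rw [pairDensity, hl]; ring
  have eN : pairNum π1 π2 a b = a + b + κ * (a * b) := rfl
  set D := pairDensity π1 π2 a b
  set N := pairNum π1 π2 a b
  have hD : 0 ≤ D := (abs_nonneg _).trans hN
  set W := N / D with hW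
  have hNW : N = W * D := by
    rcases hD.eq_or_lt with h | h
    · rw [← h] at hN ⊢
      simpa using hN
    · rw [hW]; field_simp
  have hW1 : |W| ≤ 1 := by
    rw [hW, abs_div, abs_of_nonneg hD]
    exact div_le_one_of_le₀ hN hD
  have key : D * W ^ 3 - (a ^ 3 + b ^ 3 + 3 * (a ^ 2 * b + a * b ^ 2) +
      3 * κ * (a ^ 3 * b + a * b ^ 3) + -2 * l * (a ^ 4 * b + a * b ^ 4)) = (a ^ 2 * b ^ 2) *
      ((6 * κ + 3 * (a + b) * κ ^ 2 + κ ^ 3 * (a * b) -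
      6 * l * (a + b) - 6 * l * κ * (a + b) ^ 2 -
      6 * l * (a + b) * κ ^ 2 * (a * b) - 2 * l * κ ^ 3 * (a * b) ^ 2) +
        l ^ 2 * ((1 + l * (a * b)) * (2 * (1 + l * (a * b)) + 1)) * W ^ 3) := by
    have : D * W ^ 3 = N ^ 3 * (1 - 2 * (l * (a * b))) +
        l ^ 2 * (D * (2 * D + 1)) * W ^ 3 * (a * b) ^ 2 := by
      have : l * (a * b) = D - 1 := by rw [eD]; ring
      rw [hNW, show l ^ 2 * (D * (2 * D + 1)) * W ^ 3 * (a * b) ^ 2 =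
        (D * (2 * D + 1)) * W ^ 3 * (l * (a * b)) ^ 2 by ring, this]
      ring
    rw [this, ← eD, eN]
    ring
  rw [key, abs_mul, abs_of_nonneg (by positivity : 0 ≤ a ^ 2 * b ^ 2), mul_comm]
  gcongr
  refine (abs_add_le _ _).trans (add_le_add (bC.trans (le_abs_self _)) ?_)
  rw [abs_mul]
  have hW3 : |W ^ 3| ≤ 1 := by
    rw [abs_pow]; exact pow_le_one₀ (abs_nonneg _) hW1
  calc _ ≤ |l ^ 2 * ((1 + l * (a * b)) * (2 * (1 + l * (a * b)) + 1))| * 1 := by gcongr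
    _ ≤ |C'| := by rw [mul_one]; exact bC'.trans (le_abs_self _)

end Pointwise

/-- A pair of probability vectors on a finite type: the laws of an observation given the two
possible states. -/
structure IsExperiment {Ω : Type*} [Fintype Ω] (P : Fin 2 → Ω → ℝ) : Prop where
  nonneg : ∀ i ω, 0 ≤ P i ω
  sum_eq_one : ∀ i, ∑ ω, P i ω = 1

/-- The `k`-th moment of the posterior deviation of an experiment under its mixture law. -/
noncomputable def moment (π1 π2 : ℝ) (k : ℕ) {Ω : Type*} [Fintype Ω] (P : Fin 2 → Ω → ℝ) : ℝ :=
  ∑ ω, mix π1 π2 (P 0 ω) (P 1 ω) * dev π1 π2 (P 0 ω) (P 1 ω) ^ k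

/-- Two conditionally independent observations. -/
def prodExp {Ω Ω' : Type*} (P : Fin 2 → Ω → ℝ) (Q : Fin 2 → Ω' → ℝ) : Fin 2 → Ω × Ω' → ℝ :=
  fun i ω => P i ω.1 * Q i ω.2

/-- Finitely many conditionally independent copies of an observation. -/
def powExp {Ω : Type*} (d : ℕ) (P : Fin 2 → Ω → ℝ) : Fin 2 → (Fin d → Ω) → ℝ :=
  fun i f => ∏ j, P i (f j)

/-- Observation of a state passed through the channel `K`. -/
def channelExp {Ω : Type*} (K : Fin 2 → Fin 2 → ℝ) (P : Fin 2 → Ω → ℝ) : Fin 2 → Ω → ℝ :=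
  fun i ω => ∑ c, K i c * P c ω

section Experiment

variable {π1 π2 : ℝ} {Ω Ω' : Type*} [Fintype Ω] [Fintype Ω'] {P : Fin 2 → Ω → ℝ}
  {P' : Fin 2 → Ω' → ℝ}

lemma IsExperiment.prodExp (hP : IsExperiment P) (hP' : IsExperiment P') :
    IsExperiment (prodExp P P') where
  nonneg _ _ := mul_nonneg (hP.nonneg _ _) (hP'.nonneg _ _)
  sum_eq_one i := by
    simp only [AsymIsing.prodExp]
    rw [Fintype.sum_prod_type, ← Finset.sum_mul_sum, hP.sum_eq_one, hP'.sum_eq_one, one_mul]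

lemma IsExperiment.powExp (hP : IsExperiment P) (d : ℕ) : IsExperiment (powExp d P) where
  nonneg _ _ := Finset.prod_nonneg fun _ _ => hP.nonneg _ _
  sum_eq_one i := by
    simp only [AsymIsing.powExp]
    rw [← Fintype.piFinset_univ, Finset.sum_prod_piFinset (g := fun _ b => P i b)]
    simp [hP.sum_eq_one]

lemma IsExperiment.channelExp (hP : IsExperiment P) {K : Fin 2 → Fin 2 → ℝ}
    (hK : ∀ i j, 0 ≤ K i j) (hK' : ∀ i, ∑ j, K i j = 1) : IsExperiment (channelExp K P) where
  nonneg _ _ := Finset.sum_nonneg fun _ _ => mul_nonneg (hK _ _) (hP.nonneg _ _)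
  sum_eq_one i := by
    simp only [AsymIsing.channelExp]
    rw [Finset.sum_comm]
    simp_rw [← Finset.mul_sum, hP.sum_eq_one, mul_one, hK']

lemma moment_powExp_succ (k d : ℕ) :
    moment π1 π2 k (powExp (d + 1) P) = moment π1 π2 k (prodExp P (powExp d P)) := by
  refine (Fintype.sum_equiv (Fin.consEquiv fun _ => Ω) _ _ fun ω => ?_).symm
  simp [prodExp, powExp, Fin.consEquiv, Fin.prod_univ_succ]

lemma moment_powExp_zero (k : ℕ) (hk : k ≠ 0) : moment π1 π2 k (powExp 0 P) = 0 := by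
  simp [moment, powExp, dev, hk]

lemma moment_zero (hsum : π1 + π2 = 1) (hP : IsExperiment P) : moment π1 π2 0 P = 1 := by
  simp [moment, mix, Finset.sum_add_distrib, ← Finset.mul_sum, hP.sum_eq_one, hsum]

lemma moment_one (h1 : 0 < π1) (h2 : 0 < π2) (hP : IsExperiment P) : moment π1 π2 1 P = 0 := by
  simp [moment, mix_mul_dev h1 h2 (hP.nonneg _ _) (hP.nonneg _ _), ← Finset.mul_sum,
    hP.sum_eq_one]

lemma moment_two_nonneg (h1 : 0 < π1) (h2 : 0 < π2) (hP : IsExperiment P) :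
    0 ≤ moment π1 π2 2 P :=
  Finset.sum_nonneg fun _ _ =>
    mul_nonneg (mix_nonneg h1 h2 (hP.nonneg _ _) (hP.nonneg _ _)) (sq_nonneg _)

lemma abs_moment_three_le (hsum : π1 + π2 = 1) (h1 : 0 < π1) (h2 : 0 < π2)
    (hP : IsExperiment P) : |moment π1 π2 3 P| ≤ moment π1 π2 2 P := by
  refine (Finset.abs_sum_le_sum_abs _ _).trans (Finset.sum_le_sum fun ω _ => ?_)
  have hm := mix_nonneg h1 h2 (hP.nonneg 0 ω) (hP.nonneg 1 ω)
  have hd := abs_dev_le_one hsum h1 h2 (hP.nonneg 0 ω) (hP.nonneg 1 ω)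
  rw [abs_mul, abs_of_nonneg hm, abs_pow, ← sq_abs (dev _ _ _ _)]
  exact mul_le_mul_of_nonneg_left (pow_le_pow_of_le_one (abs_nonneg _) hd (by norm_num)) hm

/-- Adding an independent observation does not decrease the second moment. -/
lemma moment_two_le_prodExp (h1 : 0 < π1) (h2 : 0 < π2)
    (hP : IsExperiment P) (hP' : IsExperiment P') :
    moment π1 π2 2 P ≤ moment π1 π2 2 (prodExp P P') := by
  rw [moment, moment, Fintype.sum_prod_type]
  refine Finset.sum_le_sum fun ω _ => ?_
  have hm := mix_nonneg h1 h2 (hP.nonneg 0 ω) (hP.nonneg 1 ω)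
  have hPP := hP.prodExp hP'
  set p := P 0 ω
  set q := P 1 ω
  have hf : ∀ ω', 0 ≤ mix π1 π2 (prodExp P P' 0 (ω, ω')) (prodExp P P' 1 (ω, ω')) :=
    fun ω' => mix_nonneg h1 h2 (hPP.nonneg _ _) (hPP.nonneg _ _)
  have cs := Finset.sum_sq_le_sum_mul_sum_of_sq_le_mul (s := (Finset.univ : Finset Ω'))
    (r := fun ω' => mix π1 π2 (prodExp P P' 0 (ω, ω')) (prodExp P P' 1 (ω, ω')) *
      dev π1 π2 (prodExp P P' 0 (ω, ω')) (prodExp P P' 1 (ω, ω')))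
    (f := fun ω' => mix π1 π2 (prodExp P P' 0 (ω, ω')) (prodExp P P' 1 (ω, ω')))
    (g := fun ω' => mix π1 π2 (prodExp P P' 0 (ω, ω')) (prodExp P P' 1 (ω, ω')) *
      dev π1 π2 (prodExp P P' 0 (ω, ω')) (prodExp P P' 1 (ω, ω')) ^ 2)
    (fun ω' _ => hf ω') (fun ω' _ => mul_nonneg (hf ω') (sq_nonneg _))
    (fun ω' _ => le_of_eq (by ring))
  have e1 : ∑ ω', mix π1 π2 (prodExp P P' 0 (ω, ω')) (prodExp P P' 1 (ω, ω')) =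
      mix π1 π2 p q := by
    simp [mix, prodExp, Finset.sum_add_distrib, ← Finset.mul_sum, hP'.sum_eq_one, p, q]
  have e2 : ∑ ω', mix π1 π2 (prodExp P P' 0 (ω, ω')) (prodExp P P' 1 (ω, ω')) *
      dev π1 π2 (prodExp P P' 0 (ω, ω')) (prodExp P P' 1 (ω, ω')) =
      mix π1 π2 p q * dev π1 π2 p q := by
    rw [mix_mul_dev h1 h2 (hP.nonneg 0 ω) (hP.nonneg 1 ω)]
    simp_rw [fun ω' => mix_mul_dev h1 h2 (hPP.nonneg 0 (ω, ω')) (hPP.nonneg 1 (ω, ω'))]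
    simp only [prodExp, mul_sub, Finset.sum_sub_distrib, ← Finset.mul_sum, hP'.sum_eq_one,
      mul_one]
  rw [e1, e2] at cs
  rcases hm.eq_or_lt with h | h
  · rw [← h, zero_mul]
    exact Finset.sum_nonneg fun ω' _ => mul_nonneg (hf ω') (sq_nonneg _)
  · refine le_of_mul_le_mul_left (le_trans (le_of_eq ?_) cs) h
    ring

lemma sum_mix_mul_mix_mul (k l : ℕ) :
    ∑ ω : Ω × Ω', mix π1 π2 (P 0 ω.1) (P 1 ω.1) * mix π1 π2 (P' 0 ω.2) (P' 1 ω.2) *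
      (dev π1 π2 (P 0 ω.1) (P 1 ω.1) ^ k * dev π1 π2 (P' 0 ω.2) (P' 1 ω.2) ^ l) =
    moment π1 π2 k P * moment π1 π2 l P' := by
  rw [moment, moment, Finset.sum_mul_sum, Fintype.sum_prod_type]
  exact Finset.sum_congr rfl fun _ _ => Finset.sum_congr rfl fun _ _ => by ring

/-- The second and third moments are additive up to the product of the second moments. -/
lemma exists_moment_prodExp_bound (hsum : π1 + π2 = 1) (h1 : 0 < π1) (h2 : 0 < π2) :
    ∃ C : ℝ, 0 ≤ C ∧ ∀ {Ω Ω' : Type} [Fintype Ω] [Fintype Ω'] {P : Fin 2 → Ω → ℝ}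
      {P' : Fin 2 → Ω' → ℝ}, IsExperiment P → IsExperiment P' →
      |moment π1 π2 2 (prodExp P P') - (moment π1 π2 2 P + moment π1 π2 2 P')| ≤
        C * (moment π1 π2 2 P * moment π1 π2 2 P') ∧
      |moment π1 π2 3 (prodExp P P') - (moment π1 π2 3 P + moment π1 π2 3 P')| ≤
        C * (moment π1 π2 2 P * moment π1 π2 2 P') := by
  obtain ⟨C, hC, c₁, c₂, hbd⟩ := exists_pair_sq_bound hsum h1 h2
  obtain ⟨C', hC', c₁', c₂', hbd'⟩ := exists_pair_cube_bound hsum h1 h2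
  refine ⟨C + C', by positivity, fun {Ω Ω'} _ _ {P P'} hP hP' => ?_⟩
  have hV := mul_nonneg (moment_two_nonneg h1 h2 hP) (moment_two_nonneg h1 h2 hP')
  have main : ∀ (k : ℕ) (B : ℝ) (p : ℝ → ℝ → ℝ),
      (∀ a b : ℝ, -π1 ≤ a → a ≤ π2 → -π1 ≤ b → b ≤ π2 →
        |pairDensity π1 π2 a b * (pairNum π1 π2 a b / pairDensity π1 π2 a b) ^ k - p a b| ≤
          B * (a ^ 2 * b ^ 2)) →
      |moment π1 π2 k (prodExp P P') - ∑ ω : Ω × Ω', mix π1 π2 (P 0 ω.1) (P 1 ω.1) *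
        mix π1 π2 (P' 0 ω.2) (P' 1 ω.2) * p (dev π1 π2 (P 0 ω.1) (P 1 ω.1))
          (dev π1 π2 (P' 0 ω.2) (P' 1 ω.2))| ≤
        B * (moment π1 π2 2 P * moment π1 π2 2 P') := by
    intro k B p hp
    rw [← sum_mix_mul_mix_mul, Finset.mul_sum, moment, ← Finset.sum_sub_distrib]
    refine (Finset.abs_sum_le_sum_abs _ _).trans (Finset.sum_le_sum fun ω _ => ?_)
    have n1 := hP.nonneg 0 ω.1
    have n2 := hP.nonneg 1 ω.1
    have n3 := hP'.nonneg 0 ω.2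
    have n4 := hP'.nonneg 1 ω.2
    have hm := mul_nonneg (mix_nonneg h1 h2 n1 n2) (mix_nonneg h1 h2 n3 n4)
    simp only [prodExp]
    rw [mix_mul_dev_pow_mul hsum h1 h2 n1 n2 n3 n4, ← mul_sub, abs_mul, abs_of_nonneg hm]
    refine (mul_le_mul_of_nonneg_left (hp _ _ (neg_le_dev hsum h1 h2 n1 n2)
      (dev_le hsum h1 h2 n1 n2) (neg_le_dev hsum h1 h2 n3 n4) (dev_le hsum h1 h2 n3 n4))
      hm).trans (le_of_eq ?_)
    ring
  have S := fun k l => sum_mix_mul_mix_mul (π1 := π1) (π2 := π2) (P := P) (P' := P') k l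
  have z := moment_zero hsum hP
  have z' := moment_zero hsum hP'
  have o := moment_one h1 h2 hP
  have o' := moment_one h1 h2 hP'
  constructor
  · refine (le_trans (le_of_eq ?_) (main 2 C _ hbd)).trans
      (mul_le_mul_of_nonneg_right (by linarith) hV)
    congr 2
    have : moment π1 π2 2 P + moment π1 π2 2 P' =
        moment π1 π2 2 P * moment π1 π2 0 P' + moment π1 π2 0 P * moment π1 π2 2 P' +
        2 * (moment π1 π2 1 P * moment π1 π2 1 P') +
        c₁ * (moment π1 π2 2 P * moment π1 π2 1 P' + moment π1 π2 1 P * moment π1 π2 2 P') +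
        c₂ * (moment π1 π2 3 P * moment π1 π2 1 P' + moment π1 π2 1 P * moment π1 π2 3 P') := by
      rw [z, z', o, o']; ring
    rw [this]
    simp only [← S, Finset.mul_sum, ← Finset.sum_add_distrib]
    exact Finset.sum_congr rfl fun _ _ => by ring
  · refine (le_trans (le_of_eq ?_) (main 3 C' _ hbd')).trans
      (mul_le_mul_of_nonneg_right (by linarith) hV)
    congr 2
    have : moment π1 π2 3 P + moment π1 π2 3 P' =
        moment π1 π2 3 P * moment π1 π2 0 P' + moment π1 π2 0 P * moment π1 π2 3 P' +
        3 * (moment π1 π2 2 P * moment π1 π2 1 P' + moment π1 π2 1 P * moment π1 π2 2 P') +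
        c₁' * (moment π1 π2 3 P * moment π1 π2 1 P' + moment π1 π2 1 P * moment π1 π2 3 P') +
        c₂' * (moment π1 π2 4 P * moment π1 π2 1 P' + moment π1 π2 1 P * moment π1 π2 4 P') := by
      rw [z, z', o, o']; ring
    rw [this]
    simp only [← S, Finset.mul_sum, ← Finset.sum_add_distrib]
    exact Finset.sum_congr rfl fun _ _ => by ring

lemma moment_two_le_one (hsum : π1 + π2 = 1) (h1 : 0 < π1) (h2 : 0 < π2)
    (hP : IsExperiment P) : moment π1 π2 2 P ≤ 1 := by
  rw [← moment_zero hsum hP]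
  refine Finset.sum_le_sum fun ω _ => mul_le_mul_of_nonneg_left ?_
    (mix_nonneg h1 h2 (hP.nonneg 0 ω) (hP.nonneg 1 ω))
  rw [pow_zero, ← sq_abs]
  exact pow_le_one₀ (abs_nonneg _) (abs_dev_le_one hsum h1 h2 (hP.nonneg 0 ω) (hP.nonneg 1 ω))

/-- The second and third moments of `d` independent copies are `d` times those of one copy, up to
an error quadratic in `d` times the second moment. -/
lemma exists_moment_powExp_bound (hsum : π1 + π2 = 1) (h1 : 0 < π1) (h2 : 0 < π2) :
    ∃ K : ℝ, 0 ≤ K ∧ ∀ {Ω : Type} [Fintype Ω] {P : Fin 2 → Ω → ℝ}, IsExperiment P → ∀ d : ℕ,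
      |moment π1 π2 2 (powExp d P) - d * moment π1 π2 2 P| ≤ K * (d * moment π1 π2 2 P) ^ 2 ∧
      |moment π1 π2 3 (powExp d P) - d * moment π1 π2 3 P| ≤
        K * (d * moment π1 π2 2 P) ^ 2 := by
  obtain ⟨C, hC, hbd⟩ := exists_moment_prodExp_bound hsum h1 h2
  refine ⟨C * (1 + C), by positivity, fun {Ω} _ {P} hP d => ?_⟩
  have hV := moment_two_nonneg h1 h2 hP
  set V := moment π1 π2 2 P
  set T := moment π1 π2 3 P
  suffices h : moment π1 π2 2 (powExp d P) ≤ d * (1 + C) * V ∧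
      |moment π1 π2 2 (powExp d P) - d * V| ≤ C * (1 + C) * (d * V) ^ 2 ∧
      |moment π1 π2 3 (powExp d P) - d * T| ≤ C * (1 + C) * (d * V) ^ 2 from h.2
  induction d with
  | zero => simp [moment_powExp_zero]
  | succ d ih =>
    obtain ⟨i1, i2, i3⟩ := ih
    have hE := hP.powExp d
    obtain ⟨b2, b3⟩ := hbd hP hE
    have hW := moment_two_nonneg h1 h2 hE
    have hW1 := moment_two_le_one hsum h1 h2 hE
    rw [moment_powExp_succ, moment_powExp_succ]
    set W := moment π1 π2 2 (powExp d P)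
    have hVW : C * (V * W) ≤ C * (1 + C) * (d * V ^ 2) := by
      calc C * (V * W) ≤ C * (V * (d * (1 + C) * V)) := by gcongr
        _ = _ := by ring
    have hq : C * (1 + C) * (d * V) ^ 2 + C * (1 + C) * (d * V ^ 2) ≤
        C * (1 + C) * ((d + 1) * V) ^ 2 := by
      have : 0 ≤ C * (1 + C) * ((d + 1) * V ^ 2) := by positivity
      linear_combination this
    have hVW' : C * (V * W) ≤ C * V := by
      have : V * W ≤ V * 1 := by gcongr
      calc C * (V * W) ≤ C * (V * 1) := by gcongr
        _ = _ := by ring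
    push_cast
    rw [abs_le] at b2 b3 i2 i3
    refine ⟨by linarith [b2.2], ?_, ?_⟩ <;> rw [abs_le] <;> constructor <;>
      linarith [b2.1, b2.2, b3.1, b3.2, i2.1, i2.2, i3.1, i3.2]

/-- Passing the state through a channel with stationary law `(π1, π2)` and second eigenvalue `θ`
multiplies the posterior deviations by `θ`. -/
lemma moment_channelExp (hsum : π1 + π2 = 1) {θ : ℝ}
    {K : Fin 2 → Fin 2 → ℝ} (h00 : K 0 0 = π1 + θ * π2) (h01 : K 0 1 = π2 * (1 - θ))
    (h10 : K 1 0 = π1 * (1 - θ)) (h11 : K 1 1 = π2 + θ * π1) (k : ℕ) :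
    moment π1 π2 k (channelExp K P) = θ ^ k * moment π1 π2 k P := by
  rw [moment, moment, Finset.mul_sum]
  refine Finset.sum_congr rfl fun ω _ => ?_
  have e1 : mix π1 π2 (channelExp K P 0 ω) (channelExp K P 1 ω) = mix π1 π2 (P 0 ω) (P 1 ω) := by
    simp only [mix, channelExp, Fin.sum_univ_two, h00, h01, h10, h11]
    obtain rfl : π2 = 1 - π1 := by linarith
    ring
  have e2 : dev π1 π2 (channelExp K P 0 ω) (channelExp K P 1 ω) =
      θ * dev π1 π2 (P 0 ω) (P 1 ω) := by
    rw [dev, e1, dev, ← mul_div_assoc]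
    congr 1
    simp only [channelExp, Fin.sum_univ_two, h00, h01, h10, h11]
    obtain rfl : π2 = 1 - π1 := by linarith
    ring
  rw [e1, e2]; ring

end Experiment

section Tree

variable {d : ℕ} {K : Fin 2 → Fin 2 → ℝ}

/-- The law of the level-`n` spins of the broadcast process along `K` started from root spin
`i`. -/
def treeLaw (d : ℕ) (K : Fin 2 → Fin 2 → ℝ) (n : ℕ) (i : Fin 2) (A : LConf d n) : ℝ :=
  ∑ σ : Conf d n, if root σ = i ∧ top σ = A then
    ∏ k : Fin n, ∏ v : Vert d (k + 1), K (σ k.castSucc (v ∘ Fin.castSucc)) (σ k.succ v) else 0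

/-- Configurations on `n + 2` levels, split into the last level and the others. -/
def splitTop (d n : ℕ) : LConf d (n + 1) × Conf d n ≃ Conf d (n + 1) :=
  Fin.snocEquiv fun k : Fin (n + 2) => Vert d k → Fin 2

lemma splitTop_castSucc {n : ℕ} (x : LConf d (n + 1) × Conf d n) (k : Fin (n + 1)) :
    splitTop d n x k.castSucc = x.2 k :=
  Fin.snoc_castSucc (α := fun k : Fin (n + 2) => Vert d k → Fin 2) x.1 x.2 k

lemma splitTop_last {n : ℕ} (x : LConf d (n + 1) × Conf d n) :
    splitTop d n x (Fin.last (n + 1)) = x.1 :=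
  Fin.snoc_last (α := fun k : Fin (n + 2) => Vert d k → Fin 2) x.1 x.2

lemma root_splitTop {n : ℕ} (x : LConf d (n + 1) × Conf d n) :
    root (splitTop d n x) = root x.2 :=
  congrFun (splitTop_castSucc x 0) _

lemma top_splitTop {n : ℕ} (x : LConf d (n + 1) × Conf d n) : top (splitTop d n x) = x.1 :=
  splitTop_last x

lemma treeLaw_zero (i : Fin 2) (A : LConf d 0) :
    treeLaw d K 0 i A = if A (fun k => k.elim0) = i then 1 else 0 := by
  have e : ∀ σ : Conf d 0, top σ = A → σ = fun _ _ => A (fun k => k.elim0) := by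
    rintro σ rfl
    funext k v
    obtain rfl := Subsingleton.elim (α := Fin 1) (Fin.last 0) k
    exact congrArg (σ (Fin.last 0)) (Subsingleton.elim (α := Fin 0 → Fin d) _ _)
  rw [treeLaw, Finset.sum_eq_single (fun _ _ => A (fun k => k.elim0))
    (fun σ _ hσ => if_neg fun h => hσ (e σ h.2)) (by simp)]
  have ht : top (d := d) (n := 0) (fun _ _ => A (fun k => k.elim0)) = A := by
    funext v
    exact congrArg A (Subsingleton.elim _ _)
  simp [ht, root]

lemma treeLaw_succ (n : ℕ) (i : Fin 2) (A : LConf d (n + 1)) :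
    treeLaw d K (n + 1) i A = ∑ B : LConf d n, treeLaw d K n i B *
      ∏ v : Vert d (n + 1), K (B (v ∘ Fin.castSucc)) (A v) := by
  have step : ∀ x : LConf d (n + 1) × Conf d n,
      (∏ k : Fin (n + 1), ∏ v : Vert d (k + 1),
        K (splitTop d n x k.castSucc (v ∘ Fin.castSucc)) (splitTop d n x k.succ v)) =
      (∏ k : Fin n, ∏ v : Vert d (k + 1),
        K (x.2 k.castSucc (v ∘ Fin.castSucc)) (x.2 k.succ v)) *
        ∏ v : Vert d (n + 1), K (top x.2 (v ∘ Fin.castSucc)) (x.1 v) := by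
    intro x
    rw [Fin.prod_univ_castSucc]
    congr 1
    · refine Finset.prod_congr rfl fun k _ => Finset.prod_congr rfl fun v _ => ?_
      exact congrArg₂ K (congrFun (splitTop_castSucc x k.castSucc) _)
        (congrFun (splitTop_castSucc x k.succ) v)
    · refine Finset.prod_congr rfl fun v _ => ?_
      exact congrArg₂ K (congrFun (splitTop_castSucc x (Fin.last n)) _)
        (congrFun (splitTop_last x) v)
  rw [treeLaw, ← (splitTop d n).sum_comp, Fintype.sum_prod_type]
  simp_rw [step, root_splitTop, top_splitTop, treeLaw, Finset.sum_mul]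
  rw [Finset.sum_comm, Finset.sum_comm (s := (Finset.univ : Finset (LConf d n)))]
  refine Finset.sum_congr rfl fun σ _ => ?_
  rw [Finset.sum_eq_single A (fun B _ hB => by simp [hB]) (by simp),
    Finset.sum_eq_single (top σ) (fun B _ hB => by simp [hB.symm]) (by simp)]
  by_cases h : root σ = i <;> simp [h]

/-- A configuration one level further is a family of configurations of the child subtrees. -/
def splitRoot (d n : ℕ) : LConf d (n + 1) ≃ (Fin d → LConf d n) where
  toFun A j := restrictChild j A
  invFun g v := g (v 0) (Fin.tail v)
  left_inv A := by
    funext v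
    simp [restrictChild]
  right_inv g := by
    funext j w
    simp [restrictChild]

lemma prod_vert_succ (n : ℕ) (f : Vert d (n + 1) → ℝ) :
    ∏ v, f v = ∏ j : Fin d, ∏ w : Vert d n, f (Fin.cons j w) := by
  rw [← (Fin.consEquiv fun _ : Fin (n + 1) => Fin d).prod_comp, Fintype.prod_prod_type]
  rfl

/-- The subtrees of the children of the root are conditionally independent. -/
lemma treeLaw_succ_eq_powExp (n : ℕ) (i : Fin 2) (A : LConf d (n + 1)) :
    treeLaw d K (n + 1) i A =
      powExp d (channelExp K (treeLaw d K n)) i (splitRoot d n A) := by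
  induction n generalizing i with
  | zero =>
    rw [treeLaw_succ, Finset.sum_eq_single (fun _ => i) _ (by simp), treeLaw_zero, if_pos rfl,
      one_mul, prod_vert_succ]
    · refine Finset.prod_congr rfl fun j _ => ?_
      simp only [channelExp, treeLaw_zero, mul_ite, mul_one, mul_zero, Finset.sum_ite_eq,
        Finset.mem_univ, if_true]
      rw [Fintype.prod_subsingleton _ (fun k => k.elim0)]
      rfl
    · intro B _ hB
      rw [treeLaw_zero, if_neg, zero_mul]
      rintro rfl
      exact hB (funext fun v => congrArg B (Subsingleton.elim _ _))
  | succ n ih =>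
    have cons_castSucc : ∀ (j : Fin d) (w : Vert d (n + 1)),
        (Fin.cons j w : Vert d (n + 2)) ∘ Fin.castSucc = Fin.cons j (w ∘ Fin.castSucc) := by
      intro j w
      funext k
      refine Fin.cases ?_ (fun k => ?_) k
      · rfl
      · simp
    rw [treeLaw_succ, ← (splitRoot d n).symm.sum_comp]
    simp_rw [ih, Equiv.apply_symm_apply, prod_vert_succ (n + 1), cons_castSucc, powExp,
      ← Finset.prod_mul_distrib]
    rw [← Fintype.piFinset_univ]
    trans ∏ j, ∑ B, channelExp K (treeLaw d K n) i B *
      ∏ w : Vert d (n + 1), K (B (w ∘ Fin.castSucc)) (splitRoot d (n + 1) A j w)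
    · rw [Finset.prod_univ_sum]
      rfl
    · refine Finset.prod_congr rfl fun j _ => ?_
      simp_rw [channelExp, treeLaw_succ, Finset.sum_mul, Finset.mul_sum]
      rw [Finset.sum_comm]
      simp_rw [mul_assoc]

lemma isExperiment_treeLaw (hK : ∀ i j, 0 ≤ K i j) (hK' : ∀ i, ∑ j, K i j = 1) (n : ℕ) :
    IsExperiment (treeLaw d K n) := by
  induction n with
  | zero =>
    refine ⟨fun i A => ?_, fun i => ?_⟩
    · rw [treeLaw_zero]; positivity
    · rw [Finset.sum_eq_single (fun _ => i) _ (by simp), treeLaw_zero, if_pos rfl]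
      intro B _ hB
      rw [treeLaw_zero, if_neg]
      rintro rfl
      exact hB (funext fun v => congrArg B (Subsingleton.elim _ _))
  | succ n ih =>
    have h := (ih.channelExp hK hK').powExp d
    refine ⟨fun i A => ?_, fun i => ?_⟩
    · rw [treeLaw_succ_eq_powExp]
      exact h.nonneg _ _
    · simp_rw [treeLaw_succ_eq_powExp]
      rw [(splitRoot d n).sum_comp]
      exact h.sum_eq_one i

lemma moment_treeLaw_succ (π1 π2 : ℝ) (k n : ℕ) :
    moment π1 π2 k (treeLaw d K (n + 1)) =
      moment π1 π2 k (powExp d (channelExp K (treeLaw d K n))) := by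
  simp_rw [moment, treeLaw_succ_eq_powExp]
  exact (splitRoot d n).sum_comp fun A =>
    mix π1 π2 (powExp d (channelExp K (treeLaw d K n)) 0 A)
      (powExp d (channelExp K (treeLaw d K n)) 1 A) *
    dev π1 π2 (powExp d (channelExp K (treeLaw d K n)) 0 A)
      (powExp d (channelExp K (treeLaw d K n)) 1 A) ^ k

variable {θ Δ : ℝ} {n : ℕ}

lemma jointProb_eq (i : Fin 2) (A : LConf d n) :
    jointProb d θ Δ n i A = pst θ Δ i * treeLaw d (Mmat θ Δ) n i A := by
  rw [jointProb, treeLaw, Finset.mul_sum]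
  refine Finset.sum_congr rfl fun σ _ => ?_
  split_ifs with h
  · rw [confProb, h.1]
  · simp

lemma levelProb_eq (A : LConf d n) :
    levelProb d θ Δ n A = mix (pst θ Δ 0) (pst θ Δ 1) (treeLaw d (Mmat θ Δ) n 0 A)
      (treeLaw d (Mmat θ Δ) n 1 A) := by
  rw [mix, ← jointProb_eq, ← jointProb_eq, jointProb, jointProb, levelProb,
    ← Finset.sum_add_distrib]
  refine Finset.sum_congr rfl fun σ _ => ?_
  have : root σ = 0 ∨ root σ = 1 := by lia
  rcases this with h | h <;> simp [h]

lemma condLevel_eq {i : Fin 2} (h : pst θ Δ i ≠ 0) (A : LConf d n) :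
    condLevel d θ Δ n i A = treeLaw d (Mmat θ Δ) n i A := by
  rw [condLevel, jointProb_eq, mul_div_cancel_left₀ _ h]

/-- Moments of the posterior given root spin `0` in terms of those under the mixture. -/
lemma pst_mul_expect1 (hsum : pst θ Δ 0 + pst θ Δ 1 = 1) (h1 : 0 < pst θ Δ 0)
    (h2 : 0 < pst θ Δ 1) (hE : IsExperiment (treeLaw d (Mmat θ Δ) n)) (k : ℕ) :
    pst θ Δ 0 * expect1 d θ Δ n (fun A => (post d θ Δ n 0 A - pst θ Δ 0) ^ k) =
      pst θ Δ 0 * moment (pst θ Δ 0) (pst θ Δ 1) k (treeLaw d (Mmat θ Δ) n) +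
        moment (pst θ Δ 0) (pst θ Δ 1) (k + 1) (treeLaw d (Mmat θ Δ) n) := by
  rw [expect1, moment, moment, Finset.mul_sum, Finset.mul_sum, ← Finset.sum_add_distrib]
  refine Finset.sum_congr rfl fun A _ => ?_
  rw [condLevel_eq h1.ne', post, jointProb_eq, levelProb_eq]
  have key := prior_mul_likelihood hsum h1 h2 (hE.nonneg 0 A) (hE.nonneg 1 A)
  set p := treeLaw d (Mmat θ Δ) n 0 A
  set q := treeLaw d (Mmat θ Δ) n 1 A
  rw [← mul_assoc, key]
  rcases eq_or_ne (mix (pst θ Δ 0) (pst θ Δ 1) p q) 0 with h | h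
  · simp [h]
  · rw [mul_div_cancel_left₀ _ h]; ring

lemma pst_mul_xseq (hsum : pst θ Δ 0 + pst θ Δ 1 = 1) (h1 : 0 < pst θ Δ 0)
    (h2 : 0 < pst θ Δ 1) (hE : IsExperiment (treeLaw d (Mmat θ Δ) n)) :
    pst θ Δ 0 * xseq d θ Δ n =
      moment (pst θ Δ 0) (pst θ Δ 1) 2 (treeLaw d (Mmat θ Δ) n) := by
  have h := pst_mul_expect1 hsum h1 h2 hE 1
  rw [moment_one h1 h2 hE, mul_zero, zero_add] at h
  rw [← h, xseq, expect1, expect1]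
  simp only [pow_one, mul_sub, Finset.sum_sub_distrib, ← Finset.sum_mul]
  simp [condLevel_eq h1.ne', hE.sum_eq_one]

lemma pst_mul_zseq_sub (hsum : pst θ Δ 0 + pst θ Δ 1 = 1) (h1 : 0 < pst θ Δ 0)
    (h2 : 0 < pst θ Δ 1) (hE : IsExperiment (treeLaw d (Mmat θ Δ) n)) :
    pst θ Δ 0 * (zseq d θ Δ n - pst θ Δ 0 * xseq d θ Δ n) =
      moment (pst θ Δ 0) (pst θ Δ 1) 3 (treeLaw d (Mmat θ Δ) n) := by
  rw [mul_sub, pst_mul_xseq hsum h1 h2 hE, zseq, pst_mul_expect1 hsum h1 h2 hE 2]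
  ring

end Tree

section Stationary

variable {π1 π2 θ : ℝ}

lemma pst_Dlt_zero (hsum : π1 + π2 = 1) (hθ : 1 - θ ≠ 0) : pst θ (Dlt θ π1 π2) 0 = π1 := by
  obtain rfl : π2 = 1 - π1 := by linarith
  simp only [pst, Dlt, if_true]
  field_simp; ring

lemma pst_Dlt_one (hsum : π1 + π2 = 1) (hθ : 1 - θ ≠ 0) : pst θ (Dlt θ π1 π2) 1 = π2 := by
  obtain rfl : π2 = 1 - π1 := by linarith
  simp only [pst, Dlt, one_ne_zero, if_false]
  field_simp; ring

lemma moment_channelExp_Mmat (hsum : π1 + π2 = 1) {Ω : Type*} [Fintype Ω] {P : Fin 2 → Ω → ℝ}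
    (k : ℕ) : moment π1 π2 k (channelExp (Mmat θ (Dlt θ π1 π2)) P) =
      θ ^ k * moment π1 π2 k P := by
  obtain rfl : π2 = 1 - π1 := by linarith
  apply moment_channelExp hsum <;> simp [Mmat, Dlt] <;> ring

lemma sum_Mmat (Δ : ℝ) (i : Fin 2) : ∑ j, Mmat θ Δ i j = 1 := by
  fin_cases i <;> simp [Mmat] <;> ring

end Stationary

/-- One step of the contraction of the ratio of third to second moment. -/
lemma abs_le_mul_of_approx {v v' t t' D θ η K a : ℝ} (hv : 0 ≤ v) (hD : 0 ≤ D) (hD1 : D ≤ 1)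
    (hη : 0 ≤ η) (hη' : η ≤ 1 / 16) (hθ : |θ| ≤ 3 / 4) (ha : 0 ≤ a) (hKv : K * v ≤ η)
    (hv' : |v' - D * v| ≤ K * (D * v) ^ 2) (ht' : |t' - D * θ * t| ≤ K * (D * v) ^ 2)
    (ht : |t| ≤ a * v) : |t'| ≤ (4 / 5 * a + 2 * η) * v' := by
  have hDv : 0 ≤ D * v := mul_nonneg hD hv
  have hK : K * (D * v) ^ 2 ≤ η * (D * v) := by
    calc K * (D * v) ^ 2 = K * v * (D * (D * v)) := by ring
      _ ≤ η * (1 * (D * v)) := by gcongr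
      _ = _ := by ring
  have hlow : (1 - η) * (D * v) ≤ v' := by linarith [(abs_le.1 hv').1]
  have h1 : |D * θ * t| ≤ 3 / 4 * a * (D * v) := by
    rw [abs_mul, abs_mul, abs_of_nonneg hD]
    calc D * |θ| * |t| ≤ D * (3 / 4) * (a * v) := by gcongr
      _ = _ := by ring
  have h2 : |t'| ≤ 3 / 4 * a * (D * v) + η * (D * v) := by
    have := abs_add_le (t' - D * θ * t) (D * θ * t)
    rw [sub_add_cancel] at this
    linarith
  calc |t'| ≤ (3 / 4 * a + η) * (D * v) := by linarith
    _ ≤ ((4 / 5 * a + 2 * η) * (1 - η)) * (D * v) := by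
        gcongr
        nlinarith [mul_nonneg ha (by linarith : 0 ≤ 1 / 16 - η),
          mul_nonneg hη (by linarith : 0 ≤ 1 / 16 - η)]
    _ = (4 / 5 * a + 2 * η) * ((1 - η) * (D * v)) := by ring
    _ ≤ _ := by gcongr

/-- Fix `ϱ > 0` and assume `|θ| > ϱ` and `dθ² ≤ 1`. For any
`0 < ε < 1` there exist `N₂ = N₂(π, ε)` and `δ = δ(π, ε, ϱ) > 0` such that if `n ≥ N₂`
and `x_n ≤ δ` then `|z_n − π₁ x_n| ≤ ε x_n`. -/
theorem zseq_concentration (π1 π2 : ℝ) (hsum : π1 + π2 = 1) (hord : π2 ≤ π1)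
    (hpi2 : 0 < π2) :
    ∀ ε : ℝ, 0 < ε → ε < 1 → ∃ N2 : ℕ, ∀ ϱ : ℝ, 0 < ϱ → ∃ δ : ℝ, 0 < δ ∧
      ∀ d : ℕ, 2 ≤ d → ∀ θ : ℝ, ϱ < |θ| →
        (∀ i j, 0 < Mmat θ (Dlt θ π1 π2) i j) → (d : ℝ) * θ ^ 2 ≤ 1 →
        ∀ n : ℕ, N2 ≤ n → xseq d θ (Dlt θ π1 π2) n ≤ δ →
          |zseq d θ (Dlt θ π1 π2) n - π1 * xseq d θ (Dlt θ π1 π2) n| ≤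
            ε * xseq d θ (Dlt θ π1 π2) n := by
  intro ε hε hε1
  have h2 : 0 < π2 := hpi2
  have h1 : 0 < π1 := h2.trans_le hord
  obtain ⟨K, hK, hbd⟩ := exists_moment_powExp_bound hsum h1 h2
  obtain ⟨N, hN⟩ := exists_pow_lt_of_lt_one (half_pos hε) (by norm_num : (4 / 5 : ℝ) < 1)
  refine ⟨N, fun ϱ hϱ => ⟨ε / 20 * ϱ ^ (2 * N) / (K + 1), by positivity, ?_⟩⟩
  intro d hd θ hθϱ hM hdθ n hn hx
  have hd' : (2 : ℝ) ≤ d := by exact_mod_cast hd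
  have hθ2 : θ ^ 2 ≤ 1 / 2 := by nlinarith [sq_nonneg θ]
  have hθ : |θ| ≤ 3 / 4 := abs_le_of_sq_le_sq (by linarith) (by norm_num)
  have hϱ1 : ϱ ≤ 1 := by linarith
  have hϱθ : ϱ ^ 2 ≤ θ ^ 2 := by
    rw [← sq_abs θ]; gcongr
  have hθ1 : 1 - θ ≠ 0 := by linarith [le_abs_self θ]
  set M := Mmat θ (Dlt θ π1 π2)
  have hM0 : ∀ i j, 0 ≤ M i j := fun i j => (hM i j).le
  have hM1 : ∀ i, ∑ j, M i j = 1 := sum_Mmat _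
  have hE : ∀ m, IsExperiment (treeLaw d M m) := isExperiment_treeLaw hM0 hM1
  have e0 := pst_Dlt_zero hsum hθ1
  have e1 := pst_Dlt_one hsum hθ1
  have hxV := pst_mul_xseq (θ := θ) (Δ := Dlt θ π1 π2) (by rw [e0, e1, hsum])
    (by rwa [e0]) (by rwa [e1]) (hE n)
  have hzT := pst_mul_zseq_sub (θ := θ) (Δ := Dlt θ π1 π2) (by rw [e0, e1, hsum])
    (by rwa [e0]) (by rwa [e1]) (hE n)
  rw [e0, e1] at hxV hzT
  set x := xseq d θ (Dlt θ π1 π2) n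
  set z := zseq d θ (Dlt θ π1 π2) n
  set v : ℕ → ℝ := fun m => moment π1 π2 2 (treeLaw d M m)
  set t : ℕ → ℝ := fun m => moment π1 π2 3 (treeLaw d M m)
  replace hxV : π1 * x = v n := hxV
  have hv : ∀ m, 0 ≤ v m := fun m => moment_two_nonneg h1 h2 (hE m)
  have hx0 : 0 ≤ x := nonneg_of_mul_nonneg_right (hxV ▸ hv n) h1
  have hstep : ∀ m, |v (m + 1) - d * θ ^ 2 * v m| ≤ K * (d * θ ^ 2 * v m) ^ 2 ∧
      |t (m + 1) - d * θ ^ 2 * θ * t m| ≤ K * (d * θ ^ 2 * v m) ^ 2 := by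
    intro m
    have := hbd ((hE m).channelExp hM0 hM1) d
    rw [← moment_treeLaw_succ, ← moment_treeLaw_succ, moment_channelExp_Mmat hsum,
      moment_channelExp_Mmat hsum] at this
    convert this using 3 <;> ring
  have hmono : ∀ m, ϱ ^ 2 * v m ≤ v (m + 1) := by
    intro m
    obtain ⟨e, rfl⟩ : ∃ e, d = e + 1 := ⟨d - 1, by omega⟩
    have hC := (hE m).channelExp hM0 hM1
    have := moment_two_le_prodExp h1 h2 hC (hC.powExp e)
    rw [← moment_powExp_succ, ← moment_treeLaw_succ, moment_channelExp_Mmat hsum] at this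
    exact (mul_le_mul_of_nonneg_right hϱθ (hv m)).trans this
  have hmono' : ∀ j m, ϱ ^ (2 * j) * v m ≤ v (m + j) := by
    intro j m
    induction j with
    | zero => simp
    | succ j ih =>
      calc ϱ ^ (2 * (j + 1)) * v m = ϱ ^ 2 * (ϱ ^ (2 * j) * v m) := by ring
        _ ≤ ϱ ^ 2 * v (m + j) := by gcongr
        _ ≤ _ := hmono (m + j)
  have hsmall : ∀ j m, j ≤ N → m + j = n → K * v m ≤ ε / 20 := by
    intro j m hj hm
    have hvn : v n ≤ ε / 20 * ϱ ^ (2 * N) / (K + 1) := by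
      refine le_trans ?_ hx
      rw [← hxV]
      exact mul_le_of_le_one_left hx0 (by linarith)
    have hp : ϱ ^ (2 * N) ≤ ϱ ^ (2 * j) := pow_le_pow_of_le_one hϱ.le hϱ1 (by omega)
    have hq : ϱ ^ (2 * N) * v m ≤ ε / 20 * ϱ ^ (2 * N) / (K + 1) :=
      ((mul_le_mul_of_nonneg_right hp (hv m)).trans (hm ▸ hmono' j m)).trans hvn
    rw [le_div_iff₀ (by linarith)] at hq
    have hr : v m * (K + 1) ≤ ε / 20 :=
      le_of_mul_le_mul_left (by linarith) (pow_pos hϱ (2 * N))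
    linarith [hv m]
  have hiter : ∀ i ≤ N, |t (n - N + i)| ≤ ((4 / 5) ^ i + ε / 2) * v (n - N + i) := by
    intro i
    induction i with
    | zero =>
      intro _
      have := abs_moment_three_le hsum h1 h2 (hE (n - N))
      have hpos := mul_nonneg hε.le (hv (n - N))
      simp only [add_zero, pow_zero]
      linarith
    | succ i ih =>
      intro hi
      have := abs_le_mul_of_approx (η := ε / 20) (hv (n - N + i)) (by positivity) hdθ
        (by linarith) (by linarith) hθ (by positivity)
        (hsmall (N - i) _ (by omega) (by omega)) (hstep _).1 (hstep _).2 (ih (by omega))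
      refine this.trans (le_of_eq ?_)
      rw [← add_assoc]
      ring
  have hfin := hiter N le_rfl
  rw [Nat.sub_add_cancel hn] at hfin
  have hT : |t n| ≤ ε * v n :=
    hfin.trans (mul_le_mul_of_nonneg_right (by linarith) (hv n))
  refine le_of_mul_le_mul_left ?_ h1
  calc π1 * |z - π1 * x| = |t n| := by
        rw [← abs_of_pos h1, ← abs_mul, abs_of_pos h1, hzT]
    _ ≤ ε * v n := hT
    _ = π1 * (ε * x) := by rw [← hxV]; ring

end AsymIsing
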